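/- arXiv:1611.09183 — 5 statements merged into one kernel-verified Lean document; each statement's English description precedes it below -/
import Mathlib

section
/- Suppose that there exist c₁, c₂, c₃ > 0, k ∈ (0, β) and δ₀ ∈ (0, 1) such that a(x) ≤ c₁ and V(x) ≥ c₂ d(x)^{−(σ+1)} |log d(x)|^{−k/β} for all x ∈ S^{δ₀}, and the Lebesgue measure of S^δ is at most c₃ δ for every δ ∈ (0, δ₀). Then condition (HP1) holds with C₀ = σ + 1: there exist C' > 0, δ₀' ∈ (0, 1) and ε₀ ∈ (0, min{(α−1)/(σ+1), β}) such that ∫_{S^δ ∖ S^{δ/2}} V^{−β+ε} dμ ≤ C' δ^{α−(σ+1)ε} |log δ|^k for every δ ∈ (0, δ₀') and every ε ∈ (0, ε₀). -/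
open MeasureTheory Metric Set
open scoped ENNReal RealInnerProductSpace

noncomputable section

/-- `f` is locally Lipschitz on the set `s`. -/
def LocLipOn {X Y : Type*} [PseudoMetricSpace X] [PseudoMetricSpace Y]
    (s : Set X) (f : X → Y) : Prop :=
  ∀ x ∈ s, ∃ K : NNReal, ∃ t ∈ nhdsWithin x s, LipschitzOnWith K f t

/-- The inner strip `S^δ = {x ∈ Ω : dist(x, ∂Ω) < δ}`. -/
def strip {m : ℕ} (Ω : Set (EuclideanSpace ℝ (Fin m))) (δ : ℝ) :
    Set (EuclideanSpace ℝ (Fin m)) :=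
  {x | x ∈ Ω ∧ Metric.infDist x (frontier Ω) < δ}

/-- The measure with density `a` with respect to Lebesgue measure restricted to `Ω`. -/
def wMeasure {m : ℕ} (Ω : Set (EuclideanSpace ℝ (Fin m))) (a : EuclideanSpace ℝ (Fin m) → ℝ) :
    Measure (EuclideanSpace ℝ (Fin m)) :=
  (volume.restrict Ω).withDensity fun x => ENNReal.ofReal (a x)


theorem measurableSet_strip {m : ℕ} {Ω : Set (EuclideanSpace ℝ (Fin m))} (hΩ : IsOpen Ω)
    (δ : ℝ) : MeasurableSet (strip Ω δ) :=
  hΩ.measurableSet.inter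
    (measurableSet_lt (continuous_infDist_pt (frontier Ω)).measurable measurable_const)

theorem wMeasure_le_of_forall_le {m : ℕ} {Ω s : Set (EuclideanSpace ℝ (Fin m))}
    {a : EuclideanSpace ℝ (Fin m) → ℝ} {c : ℝ} (hs : MeasurableSet s)
    (ha : ∀ x ∈ s, a x ≤ c) : wMeasure Ω a s ≤ ENNReal.ofReal c * volume s := by
  rw [wMeasure, withDensity_apply _ hs]
  calc ∫⁻ x in s, ENNReal.ofReal (a x) ∂(volume.restrict Ω)
      ≤ ∫⁻ _ in s, ENNReal.ofReal c ∂(volume.restrict Ω) :=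
        setLIntegral_mono' hs fun x hx => ENNReal.ofReal_le_ofReal (ha x hx)
    _ = ENNReal.ofReal c * (volume.restrict Ω) s := setLIntegral_const _ _
    _ ≤ ENNReal.ofReal c * volume s := by
        gcongr
        exact Measure.restrict_le_self

theorem one_le_abs_log {t : ℝ} (ht : 0 < t) (ht' : t ≤ 1 / 4) : 1 ≤ |Real.log t| := by
  have h : Real.log t ≤ Real.log (1 / 4) := Real.log_le_log ht ht'
  have h4 : Real.log (1 / 4) = -(2 * Real.log 2) := by
    rw [one_div, Real.log_inv, show (4 : ℝ) = 2 ^ 2 by norm_num, Real.log_pow]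
    norm_num
  have := Real.log_two_gt_d9
  rw [abs_of_neg (by linarith)]
  linarith

theorem abs_log_le_two_mul_abs_log {t δ : ℝ} (hδ : 0 < δ) (hδ' : δ ≤ 1 / 4) (ht : δ / 2 ≤ t)
    (ht' : t < δ) : |Real.log t| ≤ 2 * |Real.log δ| := by
  have h1 : Real.log (δ / 2) ≤ Real.log t := Real.log_le_log (by positivity) ht
  have h2 : Real.log t < 0 := Real.log_neg (by linarith) (by linarith)
  have h3 : Real.log δ < 0 := Real.log_neg hδ (by linarith)
  have h4 := one_le_abs_log hδ hδ'
  have h5 := Real.log_two_lt_d9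
  rw [Real.log_div hδ.ne' (by norm_num)] at h1
  rw [abs_of_neg h3] at h4 ⊢
  rw [abs_of_neg h2]
  linarith

/-- For `t` comparable to `δ`, negative powers of a quantity bounded below by
`c * t ^ (-s) * |log t| ^ (-(k / β))` are bounded, uniformly in `ε`. -/
theorem rpow_le_of_lower_bound {c s k β ε δ t v : ℝ} (hc : 0 < c) (hs : 0 < s) (hk : 0 < k)
    (hε : 0 < ε) (hεβ : ε < β) (hδ : 0 < δ) (hδ' : δ ≤ 1 / 4) (ht : δ / 2 ≤ t) (ht' : t < δ)
    (hv : c * t ^ (-s) * |Real.log t| ^ (-(k / β)) ≤ v) :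
    ‖v ^ (-β + ε)‖ ≤ max 1 c⁻¹ ^ β * δ ^ (s * (β - ε)) * (2 ^ k * |Real.log δ| ^ k) := by
  have hβ : 0 < β := hε.trans hεβ
  have hθ : 0 < β - ε := sub_pos.2 hεβ
  have htpos : 0 < t := by linarith
  have hl : 1 ≤ |Real.log t| := one_le_abs_log htpos (by linarith)
  have hlpos : 0 < |Real.log t| := by linarith
  have hlow : 0 < c * t ^ (-s) * |Real.log t| ^ (-(k / β)) := by positivity
  have hvpos : 0 < v := hlow.trans_le hv
  rw [Real.norm_of_nonneg (by positivity)]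
  have hexp : -(k / β) * (-β + ε) ≤ k := by
    have : -(k / β) * (-β + ε) = k - k / β * ε := by field_simp; ring
    have : 0 < k / β * ε := by positivity
    linarith
  calc v ^ (-β + ε)
      ≤ (c * t ^ (-s) * |Real.log t| ^ (-(k / β))) ^ (-β + ε) :=
        Real.rpow_le_rpow_of_nonpos hlow hv (by linarith)
    _ = c⁻¹ ^ (β - ε) * t ^ (s * (β - ε)) * |Real.log t| ^ (-(k / β) * (-β + ε)) := by
        rw [Real.mul_rpow (by positivity) (by positivity),
          Real.mul_rpow hc.le (by positivity), ← Real.rpow_mul htpos.le, ← Real.rpow_mul hlpos.le,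
          Real.inv_rpow hc.le, ← Real.rpow_neg hc.le]
        congr 3 <;> ring
    _ ≤ max 1 c⁻¹ ^ β * δ ^ (s * (β - ε)) * (2 ^ k * |Real.log δ| ^ k) := by
        gcongr
        · calc c⁻¹ ^ (β - ε) ≤ max 1 c⁻¹ ^ (β - ε) :=
                Real.rpow_le_rpow (by positivity) (le_max_right _ _) hθ.le
            _ ≤ max 1 c⁻¹ ^ β :=
                Real.rpow_le_rpow_of_exponent_le (le_max_left _ _) (by linarith)
        · rw [← Real.mul_rpow (by norm_num) (abs_nonneg _)]
          exact (Real.rpow_le_rpow_of_exponent_le hl hexp).trans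
            (Real.rpow_le_rpow hlpos.le (abs_log_le_two_mul_abs_log hδ hδ' ht ht') hk.le)

/-- **A sufficient condition for (HP1) with `C₀ = σ + 1`.**  If `a` is bounded,
`V(x) ≥ c₂ d(x)^{-(σ+1)} |log d(x)|^{-k/β}` near the boundary, and the Lebesgue measure of
`S^δ` is at most `c₃ δ`, then (HP1) holds with `C₀ = σ + 1`. -/
theorem sufficient_HP1' {m : ℕ} (hm : 1 ≤ m)
    (Ω : Set (EuclideanSpace ℝ (Fin m)))
    (hΩo : IsOpen Ω) (hΩb : Bornology.IsBounded Ω) (hΩconn : IsConnected Ω)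
    (a V : EuclideanSpace ℝ (Fin m) → ℝ)
    (haLip : LocLipOn Ω a) (haPos : ∀ x ∈ Ω, 0 < a x)
    (p σ α β : ℝ) (hp : 1 < p) (hσ : p - 1 < σ)
    (hα : α = p * σ / (σ - p + 1)) (hβ : β = (p - 1) / (σ - p + 1))
    (hVmeas : Measurable V)
    (hVloc : LocallyIntegrableOn V Ω volume)
    (hVpos : ∀ᵐ x ∂volume.restrict Ω, 0 < V x)
    (c₁ c₂ c₃ k δ₀ : ℝ) (hc₁ : 0 < c₁) (hc₂ : 0 < c₂) (hc₃ : 0 < c₃)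
    (hk : 0 < k) (hkβ : k < β) (hδ₀ : 0 < δ₀) (hδ₀1 : δ₀ < 1)
    (haBound : ∀ x ∈ strip Ω δ₀, a x ≤ c₁)
    (hVbound : ∀ x ∈ strip Ω δ₀,
      c₂ * Metric.infDist x (frontier Ω) ^ (-(σ + 1)) *
          |Real.log (Metric.infDist x (frontier Ω))| ^ (-(k / β)) ≤ V x)
    (hvol : ∀ δ : ℝ, 0 < δ → δ < δ₀ → volume (strip Ω δ) ≤ ENNReal.ofReal (c₃ * δ)) :
    ∃ C' > (0:ℝ), ∃ δ₀' : ℝ, 0 < δ₀' ∧ δ₀' < 1 ∧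
      ∃ ε₀ : ℝ, 0 < ε₀ ∧ ε₀ < min ((α - 1) / (σ + 1)) β ∧
      ∀ δ : ℝ, 0 < δ → δ < δ₀' → ∀ ε : ℝ, 0 < ε → ε < ε₀ →
        ∫ x in strip Ω δ \ strip Ω (δ / 2), V x ^ (-β + ε) ∂(wMeasure Ω a) ≤
          C' * δ ^ (α - (σ + 1) * ε) * |Real.log δ| ^ k := by
  have hden : 0 < σ - p + 1 := by linarith
  have hβpos : 0 < β := hk.trans hkβ
  have hσpos : 0 < σ + 1 := by linarith
  have hαβ : α = (σ + 1) * β + 1 := by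
    rw [hα, hβ]
    field_simp
    ring
  have hmin : min ((α - 1) / (σ + 1)) β = β := by
    rw [hαβ, add_sub_cancel_right, mul_div_cancel_left₀ _ hσpos.ne', min_self]
  refine ⟨max 1 c₂⁻¹ ^ β * 2 ^ k * (c₁ * c₃), by positivity, min δ₀ (1 / 4), by positivity,
    (min_le_left _ _).trans_lt hδ₀1, β / 2, by positivity, by rw [hmin]; linarith, ?_⟩
  intro δ hδ hδlt ε hε hεlt
  have hδ4 : δ ≤ 1 / 4 := (hδlt.trans_le (min_le_right _ _)).le
  have hδδ₀ : δ < δ₀ := hδlt.trans_le (min_le_left _ _)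
  have hsub : ∀ x ∈ strip Ω δ \ strip Ω (δ / 2), x ∈ strip Ω δ₀ :=
    fun x hx => ⟨hx.1.1, hx.1.2.trans hδδ₀⟩
  have hμ : wMeasure Ω a (strip Ω δ \ strip Ω (δ / 2)) ≤ ENNReal.ofReal (c₁ * (c₃ * δ)) :=
    calc wMeasure Ω a (strip Ω δ \ strip Ω (δ / 2))
        ≤ ENNReal.ofReal c₁ * volume (strip Ω δ \ strip Ω (δ / 2)) :=
          wMeasure_le_of_forall_le
            ((measurableSet_strip hΩo δ).diff (measurableSet_strip hΩo (δ / 2)))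
            fun x hx => haBound x (hsub x hx)
      _ ≤ ENNReal.ofReal c₁ * ENNReal.ofReal (c₃ * δ) := by
          gcongr
          exact (measure_mono sdiff_subset).trans (hvol δ hδ hδδ₀)
      _ = ENNReal.ofReal (c₁ * (c₃ * δ)) := (ENNReal.ofReal_mul hc₁.le).symm
  have hbound : ∀ x ∈ strip Ω δ \ strip Ω (δ / 2), ‖V x ^ (-β + ε)‖ ≤
      max 1 c₂⁻¹ ^ β * δ ^ ((σ + 1) * (β - ε)) * (2 ^ k * |Real.log δ| ^ k) := fun x hx =>
    rpow_le_of_lower_bound hc₂ hσpos hk hε (by linarith) hδ hδ4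
      (not_lt.1 fun h => hx.2 ⟨hx.1.1, h⟩) hx.1.2 (hVbound x (hsub x hx))
  calc ∫ x in strip Ω δ \ strip Ω (δ / 2), V x ^ (-β + ε) ∂(wMeasure Ω a)
      ≤ ‖∫ x in strip Ω δ \ strip Ω (δ / 2), V x ^ (-β + ε) ∂(wMeasure Ω a)‖ :=
        Real.le_norm_self _
    _ ≤ max 1 c₂⁻¹ ^ β * δ ^ ((σ + 1) * (β - ε)) * (2 ^ k * |Real.log δ| ^ k) *
          (wMeasure Ω a).real (strip Ω δ \ strip Ω (δ / 2)) :=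
        norm_setIntegral_le_of_norm_le_const (hμ.trans_lt ENNReal.ofReal_lt_top) hbound
    _ ≤ max 1 c₂⁻¹ ^ β * δ ^ ((σ + 1) * (β - ε)) * (2 ^ k * |Real.log δ| ^ k) *
          (c₁ * (c₃ * δ)) := by
        gcongr
        exact ENNReal.toReal_le_of_le_ofReal (by positivity) hμ
    _ = max 1 c₂⁻¹ ^ β * 2 ^ k * (c₁ * c₃) * δ ^ (α - (σ + 1) * ε) * |Real.log δ| ^ k := by
        rw [show α - (σ + 1) * ε = (σ + 1) * (β - ε) + 1 by rw [hαβ]; ring,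
          Real.rpow_add_one hδ.ne']
        ring
end
end

section
/- Assume that there exist constants C₁ > C₀ > 0 and β₁ ≥ β₀ > 2 such that C₀ d(x)^{−β₀} ≤ V(x) ≤ C₁ d(x)^{−β₁} for all x ∈ Ω. Then λ̄(Ω) = 0; that is, for every η > 0 there exists φ ∈ C_c^∞(Ω) with ∫_Ω V φ² dx > 0 and ∫_Ω |∇φ|² dx < η ∫_Ω V φ² dx. -/
open MeasureTheory Metric Set Filter
open scoped ENNReal

noncomputable section

/-- A ball around a point of an open set, of radius the distance to the frontier, stays inside. -/
lemma ball_infDist_frontier_subset {E : Type*} [SeminormedAddCommGroup E] [NormedSpace ℝ E]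
    {Ω : Set E} (hΩ : IsOpen Ω) {x : E} (hx : x ∈ Ω) :
    ball x (infDist x (frontier Ω)) ⊆ Ω := by
  rcases le_or_gt (infDist x (frontier Ω)) 0 with h | h
  · simp [ball_eq_empty.2 h]
  refine (convex_ball x _).isPreconnected.subset_left_of_subset_union hΩ
    (isClosed_closure (s := Ω)).isOpen_compl ?_ ?_ ⟨x, mem_ball_self h, hx⟩
  · exact Set.disjoint_left.2 fun y hy hy' => hy' (subset_closure hy)
  · intro y hy
    by_contra hcon
    simp only [mem_union, mem_compl_iff, not_or, not_not] at hcon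
    have hyf : y ∈ frontier Ω := by
      rw [hΩ.frontier_eq]
      exact ⟨hcon.2, hcon.1⟩
    have := infDist_le_dist_of_mem (x := x) hyf
    rw [mem_ball, dist_comm] at hy
    linarith

/-- A nonempty bounded set in a nontrivial real normed space has nonempty frontier. -/
lemma frontier_nonempty_of_isBounded {E : Type*} [NormedAddCommGroup E] [NormedSpace ℝ E]
    [Nontrivial E] {Ω : Set E} (hb : Bornology.IsBounded Ω) (hne : Ω.Nonempty) :
    (frontier Ω).Nonempty := by
  rw [nonempty_iff_ne_empty]
  intro h
  rw [frontier_eq_empty_iff] at h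
  rcases h with h | h
  · exact hne.ne_empty h
  · exact NormedSpace.unbounded_univ ℝ E (h ▸ hb)

/-- An open set with nonempty frontier has points arbitrarily close to the frontier. -/
lemma exists_mem_infDist_frontier_lt {E : Type*} [PseudoMetricSpace E] {Ω : Set E}
    (hΩ : IsOpen Ω) (hne : (frontier Ω).Nonempty) {ε : ℝ} (hε : 0 < ε) :
    ∃ x ∈ Ω, 0 < infDist x (frontier Ω) ∧ infDist x (frontier Ω) < ε := by
  obtain ⟨z, hz⟩ := hne
  obtain ⟨x, hx, hxz⟩ := Metric.mem_closure_iff.1 (frontier_subset_closure hz) ε hε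
  refine ⟨x, hx, ?_, ?_⟩
  · refine (isClosed_frontier.notMem_iff_infDist_pos ⟨z, hz⟩).1 fun hxf => ?_
    rw [hΩ.frontier_eq] at hxf
    exact hxf.2 hx
  · rw [dist_comm] at hxz
    exact (infDist_le_dist_of_mem hz).trans_lt hxz

/-- **Proposition (vanishing of the bottom of the spectrum).**  If
`C₀ d(x)^{-β₀} ≤ V(x) ≤ C₁ d(x)^{-β₁}` on `Ω` with `β₁ ≥ β₀ > 2`, then `λ̄(Ω) = 0`:
for every `η > 0` there is a smooth compactly supported test function whose Rayleigh
quotient is below `η`. -/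
theorem lambda_bar_eq_zero_of_potential_bounds {m : ℕ} (hm : 1 ≤ m)
    (Ω : Set (EuclideanSpace ℝ (Fin m)))
    (hΩo : IsOpen Ω) (hΩb : Bornology.IsBounded Ω) (hΩconn : IsConnected Ω)
    (V : EuclideanSpace ℝ (Fin m) → ℝ)
    (hVcont : ContinuousOn V Ω) (hVpos : ∀ x ∈ Ω, 0 < V x)
    (C₀ C₁ β₀ β₁ : ℝ) (hC₀ : 0 < C₀) (hC₀₁ : C₀ < C₁)
    (hβ₀ : 2 < β₀) (hβ₀₁ : β₀ ≤ β₁)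
    (hVlb : ∀ x ∈ Ω, C₀ * Metric.infDist x (frontier Ω) ^ (-β₀) ≤ V x)
    (hVub : ∀ x ∈ Ω, V x ≤ C₁ * Metric.infDist x (frontier Ω) ^ (-β₁)) :
    ∀ η : ℝ, 0 < η → ∃ φ : EuclideanSpace ℝ (Fin m) → ℝ,
      ContDiff ℝ (⊤ : ℕ∞) φ ∧ HasCompactSupport φ ∧ tsupport φ ⊆ Ω ∧
      (0 < ∫ x in Ω, V x * φ x ^ 2) ∧
      (∫ x in Ω, ‖gradient φ x‖ ^ 2) < η * ∫ x in Ω, V x * φ x ^ 2 := by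
  intro η hη
  have : Nonempty (Fin m) := ⟨⟨0, hm⟩⟩
  let ψ : ContDiffBump (0 : EuclideanSpace ℝ (Fin m)) :=
    ⟨1 / 4, 1 / 2, by norm_num, by norm_num⟩
  have hψc : ContDiff ℝ (⊤ : ℕ∞) ψ := ψ.contDiff
  set A := ∫ y, ‖fderiv ℝ ψ y‖ ^ 2 with hA
  set B := ∫ y, ψ y ^ 2 with hB
  have hBpos : 0 < B := by
    refine Continuous.integral_pos_of_hasCompactSupport_nonneg_nonzero (x := 0)
      (ψ.continuous.pow 2) ?_ (fun y => sq_nonneg _) ?_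
    · exact ψ.hasCompactSupport.comp_left (g := fun t : ℝ => t ^ 2) (by simp)
    · have h1 : ψ 0 = 1 := ψ.one_of_mem_closedBall (mem_closedBall_self (by norm_num))
      simp [h1]
  have hfr : (frontier Ω).Nonempty := frontier_nonempty_of_isBounded hΩb hΩconn.nonempty
  obtain ⟨ε, hε, hεA⟩ : ∃ ε > 0, ∀ t : ℝ, 0 < t → t < ε →
      4 * A / (η * C₀ * B) < t ^ (2 - β₀) := by
    have h := (tendsto_rpow_neg_nhdsGT_zero (y := 2 - β₀) (by linarith)).eventually_gt_atTop
      (4 * A / (η * C₀ * B))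
    obtain ⟨ε, hε, h⟩ := mem_nhdsGT_iff_exists_Ioo_subset.1 h
    exact ⟨ε, hε, fun t h0 h1 => h ⟨h0, h1⟩⟩
  obtain ⟨x, hx, hr, hrε⟩ := exists_mem_infDist_frontier_lt hΩo hfr (half_pos hε)
  have hball := ball_infDist_frontier_subset hΩo hx
  set r := infDist x (frontier Ω)
  let φ : EuclideanSpace ℝ (Fin m) → ℝ := fun y => ψ (r⁻¹ • (y - x))
  have hφ : ContDiff ℝ (⊤ : ℕ∞) φ :=
    hψc.comp ((contDiff_id.sub contDiff_const).const_smul r⁻¹)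
  have hsupp : Function.support φ ⊆ closedBall x (r / 2) := by
    intro y hy
    have h1 : r⁻¹ • (y - x) ∈ Function.support ψ := hy
    rw [ψ.support_eq, mem_ball_zero_iff, norm_smul, norm_inv, Real.norm_of_nonneg hr.le,
      inv_mul_lt_iff₀ hr] at h1
    rw [mem_closedBall, dist_eq_norm]
    change ‖y - x‖ < r * (1 / 2) at h1
    linarith
  have hcs : HasCompactSupport φ :=
    HasCompactSupport.of_support_subset_isCompact (isCompact_closedBall x (r / 2)) hsupp
  have hts' : tsupport φ ⊆ closedBall x (r / 2) := closure_minimal hsupp isClosed_closedBall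
  have hts : tsupport φ ⊆ Ω :=
    (hts'.trans (closedBall_subset_ball (by linarith))).trans hball
  have hzero : ∀ y, y ∉ tsupport φ → φ y = 0 := fun y hy => image_eq_zero_of_notMem_tsupport hy
  have hscale : ∀ f : EuclideanSpace ℝ (Fin m) → ℝ,
      ∫ y, f (r⁻¹ • (y - x)) = r ^ m * ∫ y, f y := by
    intro f
    rw [integral_sub_right_eq_self (fun y => f (r⁻¹ • y)) x, Measure.integral_comp_smul]
    simp [abs_of_pos hr]
  have hfd : ∀ y, fderiv ℝ φ y = r⁻¹ • fderiv ℝ ψ (r⁻¹ • (y - x)) := by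
    intro y
    have h1 : φ = fun y => (fun w => ψ (r⁻¹ • w)) (y - x) := rfl
    rw [h1, fderiv_comp_sub (f := fun w => ψ (r⁻¹ • w)), fderiv_comp_smul]
  have hgrad : ∫ y in Ω, ‖gradient φ y‖ ^ 2 ≤ r⁻¹ ^ 2 * (r ^ m * A) := by
    have h1 : ∀ y, ‖gradient φ y‖ ^ 2 = ‖fderiv ℝ φ y‖ ^ 2 := fun y => by
      rw [gradient, LinearIsometryEquiv.norm_map]
    simp_rw [h1]
    calc ∫ y in Ω, ‖fderiv ℝ φ y‖ ^ 2 ≤ ∫ y, ‖fderiv ℝ φ y‖ ^ 2 := by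
          refine setIntegral_le_integral ?_ (ae_of_all _ fun y => sq_nonneg _)
          refine Continuous.integrable_of_hasCompactSupport
            ((hφ.continuous_fderiv (by simp)).norm.pow 2) ?_
          exact (hcs.fderiv (𝕜 := ℝ)).comp_left (g := fun L => ‖L‖ ^ 2) (by simp)
      _ = r⁻¹ ^ 2 * (r ^ m * A) := by
          rw [hA, ← hscale, ← integral_const_mul]
          refine integral_congr_ae (ae_of_all _ fun y => ?_)
          simp only [hfd, norm_smul, norm_inv, Real.norm_of_nonneg hr.le, mul_pow]
  have hφsq : Integrable fun y => φ y ^ 2 :=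
    Continuous.integrable_of_hasCompactSupport (hφ.continuous.pow 2)
      (hcs.comp_left (g := fun t : ℝ => t ^ 2) (by simp))
  have hVint : IntegrableOn (fun y => V y * φ y ^ 2) Ω := by
    refine IntegrableOn.of_forall_sdiff_eq_zero (s := tsupport φ) ?_ hΩo.measurableSet ?_
    · exact ((hVcont.mono hts).mul (hφ.continuous.pow 2).continuousOn).integrableOn_compact hcs
    · intro y hy
      simp [hzero y hy.2]
  have hlow : C₀ * (2 * r) ^ (-β₀) * (r ^ m * B) ≤ ∫ y in Ω, V y * φ y ^ 2 := by
    calc C₀ * (2 * r) ^ (-β₀) * (r ^ m * B) = ∫ y, C₀ * (2 * r) ^ (-β₀) * φ y ^ 2 := by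
          rw [integral_const_mul, hB, ← hscale]
      _ = ∫ y in Ω, C₀ * (2 * r) ^ (-β₀) * φ y ^ 2 := by
          refine (setIntegral_eq_integral_of_forall_compl_eq_zero fun y hy => ?_).symm
          simp [hzero y fun h => hy (hts h)]
      _ ≤ ∫ y in Ω, V y * φ y ^ 2 := by
          refine setIntegral_mono_on (hφsq.const_mul _).integrableOn hVint hΩo.measurableSet
            fun y hy => ?_
          by_cases hyt : y ∈ tsupport φ
          · refine mul_le_mul_of_nonneg_right ((mul_le_mul_of_nonneg_left ?_ hC₀.le).trans
              (hVlb y hy)) (sq_nonneg _)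
            have hyd : dist y x ≤ r / 2 := hts' hyt
            have h1 : infDist x (frontier Ω) ≤ infDist y (frontier Ω) + dist x y :=
              infDist_le_infDist_add_dist
            have h2 : infDist y (frontier Ω) ≤ infDist x (frontier Ω) + dist y x :=
              infDist_le_infDist_add_dist
            rw [dist_comm] at h1
            exact Real.rpow_le_rpow_of_nonpos (by linarith) (by linarith) (by linarith)
          · simp [hzero y hyt]
  have h2r : 0 < 2 * r := by linarith
  have hc : 0 < C₀ * (2 * r) ^ (-β₀) * (r ^ m * B) := by positivity
  refine ⟨φ, hφ, hcs, hts, hc.trans_le hlow, hgrad.trans_lt ?_⟩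
  refine lt_of_lt_of_le ?_ (mul_le_mul_of_nonneg_left hlow hη.le)
  have h1 := hεA (2 * r) h2r (by linarith)
  rw [div_lt_iff₀ (by positivity), sub_eq_add_neg, Real.rpow_add h2r, Real.rpow_two] at h1
  have h2 : 0 < r⁻¹ ^ 2 * r ^ m := by positivity
  calc r⁻¹ ^ 2 * (r ^ m * A) = r⁻¹ ^ 2 * r ^ m * A := by ring
    _ < r⁻¹ ^ 2 * r ^ m * (r ^ 2 * (2 * r) ^ (-β₀) * (η * C₀ * B)) := by
        refine mul_lt_mul_of_pos_left ?_ h2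
        linarith
    _ = η * (C₀ * (2 * r) ^ (-β₀) * (r ^ m * B)) := by
        field_simp
end
end

section
/- There exist a constant C > 0 and δ₁ ∈ (0, δ*) such that for every δ ∈ (0, δ₁) and every ε ∈ (0, β), ∫_{S^δ ∖ S^{δ/2}} V^{−β+ε} dμ ≤ C e^{−εθ|log δ|^τ} δ^α |log δ|^{β₀}. In particular, condition (HP3) holds for this choice of a and V (with C₀ = 0 and k = β₀). -/
open MeasureTheory Metric Set
open scoped ENNReal

noncomputable section

/-- The inner strip `S^δ = {x ∈ B₁ : 1 - |x| < δ}` of the unit ball of `ℝ^m`. -/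
def ballStrip (m : ℕ) (δ : ℝ) : Set (EuclideanSpace ℝ (Fin m)) :=
  {x | ‖x‖ < 1 ∧ 1 - ‖x‖ < δ}

theorem ballStrip_eq_preimage (m : ℕ) (δ : ℝ) :
    ballStrip m δ = norm ⁻¹' Ioo (1 - δ) 1 := by
  ext x
  simp only [ballStrip, mem_ofPred_eq, mem_preimage, mem_Ioo]
  constructor <;> rintro ⟨h₁, h₂⟩ <;> constructor <;> linarith

theorem measurableSet_ballStrip (m : ℕ) (δ : ℝ) : MeasurableSet (ballStrip m δ) := by
  rw [ballStrip_eq_preimage]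
  exact measurable_norm measurableSet_Ioo

theorem ballStrip_mono (m : ℕ) {δ δ' : ℝ} (h : δ ≤ δ') : ballStrip m δ ⊆ ballStrip m δ' :=
  fun _ hx => ⟨hx.1, hx.2.trans_le h⟩

/-- The strip `S^δ` has Lebesgue measure `O(δ)`. -/
theorem volume_real_ballStrip_le (m : ℕ) {δ : ℝ} (hδ : 0 < δ) (hδ1 : δ < 1) :
    volume.real (ballStrip m δ) ≤
      volume.real (ball (0 : EuclideanSpace ℝ (Fin m)) 1) * m * δ := by
  have hsub : ballStrip m δ ⊆
      ball (0 : EuclideanSpace ℝ (Fin m)) 1 \ closedBall 0 (1 - δ) := by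
    intro x hx
    refine ⟨mem_ball_zero_iff.2 hx.1, fun h => ?_⟩
    have h₁ := mem_closedBall_zero_iff.1 h
    have h₂ := hx.2
    linarith
  have hvol : volume.real (closedBall (0 : EuclideanSpace ℝ (Fin m)) (1 - δ)) =
      (1 - δ) ^ m * volume.real (ball (0 : EuclideanSpace ℝ (Fin m)) 1) := by
    have h := Measure.addHaar_real_closedBall (volume : Measure (EuclideanSpace ℝ (Fin m))) 0
      (sub_nonneg.2 hδ1.le)
    simpa using h
  have hbern : 1 - m * δ ≤ (1 - δ) ^ m := by
    have h := one_add_mul_le_pow (a := -δ) (by linarith) m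
    rw [← sub_eq_add_neg] at h
    linarith
  have hdiff := measureReal_sdiff (μ := volume)
    (closedBall_subset_ball (x := (0 : EuclideanSpace ℝ (Fin m)))
      (sub_lt_self 1 hδ)) measurableSet_closedBall
  have hmono := measureReal_mono (μ := volume) hsub
    (measure_ne_top_of_subset sdiff_subset measure_ball_lt_top.ne)
  have hc : 0 ≤ volume.real (ball (0 : EuclideanSpace ℝ (Fin m)) 1) := measureReal_nonneg
  calc volume.real (ballStrip m δ)
      ≤ volume.real (ball (0 : EuclideanSpace ℝ (Fin m)) 1) * (1 - (1 - δ) ^ m) := by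
        rw [hdiff, hvol] at hmono
        linarith
    _ ≤ _ := by
        rw [mul_assoc]
        exact mul_le_mul_of_nonneg_left (by linarith) hc

/-- On the dyadic annulus `δ / 2 ≤ t < δ` the weight `t^{α-1} |log t|^{β₀} e^{-c |log t|^τ}` is
controlled by its value at `δ`. -/
theorem rpow_mul_abs_log_rpow_mul_exp_le {α β₀ c τ δ t : ℝ} (hα : 1 ≤ α) (hβ₀ : 0 ≤ β₀)
    (hc : 0 ≤ c) (hτ : 0 ≤ τ) (hδ : 0 < δ) (hδ2 : δ ≤ 1 / 2) (ht : δ / 2 ≤ t) (htδ : t ≤ δ) :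
    t ^ (α - 1) * |Real.log t| ^ β₀ * Real.exp (-c * |Real.log t| ^ τ) ≤
      δ ^ (α - 1) * (2 ^ β₀ * |Real.log δ| ^ β₀) * Real.exp (-c * |Real.log δ| ^ τ) := by
  have ht0 : 0 < t := by linarith
  have hlogt : Real.log t ≤ Real.log δ := Real.log_le_log ht0 htδ
  have hlogδ : Real.log δ ≤ -Real.log 2 := by
    have h := Real.log_le_log hδ hδ2
    rwa [one_div, Real.log_inv] at h
  have hlog2 : 0 < Real.log 2 := Real.log_pos one_lt_two
  have hlow : Real.log δ - Real.log 2 ≤ Real.log t := by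
    rw [← Real.log_div hδ.ne' two_ne_zero]
    exact Real.log_le_log (by positivity) ht
  have habs : |Real.log δ| ≤ |Real.log t| := by
    rw [abs_of_neg (by linarith), abs_of_neg (by linarith)]
    linarith
  have habs2 : |Real.log t| ≤ 2 * |Real.log δ| := by
    rw [abs_of_neg (by linarith : Real.log t < 0), abs_of_neg (by linarith : Real.log δ < 0)]
    linarith
  have h1 : t ^ (α - 1) ≤ δ ^ (α - 1) := Real.rpow_le_rpow ht0.le htδ (by linarith)
  have h2 : |Real.log t| ^ β₀ ≤ 2 ^ β₀ * |Real.log δ| ^ β₀ := by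
    rw [← Real.mul_rpow two_pos.le (abs_nonneg _)]
    exact Real.rpow_le_rpow (abs_nonneg _) habs2 hβ₀
  have h3 : Real.exp (-c * |Real.log t| ^ τ) ≤ Real.exp (-c * |Real.log δ| ^ τ) := by
    rw [Real.exp_le_exp, neg_mul, neg_mul, neg_le_neg_iff]
    exact mul_le_mul_of_nonneg_left (Real.rpow_le_rpow (abs_nonneg _) habs hτ) hc
  gcongr

/-- A set integral against a measure with density `a` on `S` is bounded by the supremum of
`|f| a` times the volume of the set. -/
theorem setIntegral_withDensity_ofReal_le {X : Type*} [MeasurableSpace X] {ν : Measure X}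
    {S A : Set X} (hS : MeasurableSet S) (hA : MeasurableSet A) (hAS : A ⊆ S) (hfin : ν A < ∞)
    {a g f : X → ℝ} (hg : Measurable g) (hag : EqOn a g S) {M : ℝ}
    (ha : ∀ x ∈ A, 0 ≤ g x) (hM : ∀ x ∈ A, g x * |f x| ≤ M) :
    ∫ x in A, f x ∂((ν.restrict S).withDensity fun x => ENNReal.ofReal (a x)) ≤
      M * ν.real A := by
  have hcongr : (ν.restrict S).withDensity (fun x => ENNReal.ofReal (a x)) =
      (ν.restrict S).withDensity fun x => ENNReal.ofReal (g x) := by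
    refine withDensity_congr_ae ?_
    filter_upwards [ae_restrict_mem hS] with x hx
    rw [hag hx]
  rw [hcongr, restrict_withDensity hA, Measure.restrict_restrict hA, inter_eq_left.2 hAS,
    integral_withDensity_eq_integral_toReal_smul hg.ennreal_ofReal
      (Filter.Eventually.of_forall fun _ => ENNReal.ofReal_lt_top)]
  refine (Real.le_norm_self _).trans (norm_setIntegral_le_of_norm_le_const hfin fun x hx => ?_)
  rw [ENNReal.toReal_ofReal (ha x hx), smul_eq_mul, norm_mul, Real.norm_of_nonneg (ha x hx)]
  exact hM x hx

/-- **Example: (HP3) holds.**  For `a(x) = d(x)^{α-1} |log d(x)|^{β₀} e^{-βθ|log d(x)|^τ}`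
and `V(x) = e^{-θ|log d(x)|^τ}` on `S^{δ*}` (where `d(x) = 1 - |x|`), one has
`∫_{S^δ ∖ S^{δ/2}} V^{-β+ε} dμ ≤ C e^{-εθ|log δ|^τ} δ^α |log δ|^{β₀}` for all small `δ`
and all `ε ∈ (0, β)`; in particular condition (HP3) holds (with `C₀ = 0`, `k = β₀`). -/
theorem example_HP3_holds {m : ℕ} (hm : 2 ≤ m)
    (p σ α β δstar β₀ θ τ : ℝ)
    (hp : 1 < p) (hσ : p - 1 < σ)
    (hα : α = p * σ / (σ - p + 1)) (hβ : β = (p - 1) / (σ - p + 1))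
    (hδs : 0 < δstar) (hδs2 : δstar < 1 / 2)
    (hβ₀ : β < β₀) (hθ : 0 < θ) (hτ : max ((σ - p + 1) * (β₀ + 1) / σ) 1 < τ)
    (a V : EuclideanSpace ℝ (Fin m) → ℝ)
    (ha : ∀ x ∈ ballStrip m δstar,
      a x = (1 - ‖x‖) ^ (α - 1) * |Real.log (1 - ‖x‖)| ^ β₀ *
        Real.exp (-β * θ * |Real.log (1 - ‖x‖)| ^ τ))
    (hV : ∀ x ∈ ballStrip m δstar,
      V x = Real.exp (-θ * |Real.log (1 - ‖x‖)| ^ τ))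
    (μ : Measure (EuclideanSpace ℝ (Fin m)))
    (hμ : μ = (volume.restrict (ballStrip m δstar)).withDensity
      fun x => ENNReal.ofReal (a x)) :
    (∃ C > (0:ℝ), ∃ δ₁ : ℝ, 0 < δ₁ ∧ δ₁ < δstar ∧
      ∀ δ : ℝ, 0 < δ → δ < δ₁ → ∀ ε : ℝ, 0 < ε → ε < β →
        ∫ x in ballStrip m δ \ ballStrip m (δ / 2), V x ^ (-β + ε) ∂μ ≤
          C * Real.exp (-ε * θ * |Real.log δ| ^ τ) * δ ^ α * |Real.log δ| ^ β₀) ∧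
    -- in particular, condition (HP3) holds with `C₀ = 0` and `k = β₀`
    (∃ C' > (0:ℝ), ∃ δ₀ : ℝ, 0 < δ₀ ∧ δ₀ < 1 ∧
      ∃ ε₀ : ℝ, 0 < ε₀ ∧ ε₀ < β ∧
      ∀ δ : ℝ, 0 < δ → δ < δ₀ → ∀ ε : ℝ, 0 < ε → ε < ε₀ →
        ∫ x in ballStrip m δ \ ballStrip m (δ / 2), V x ^ (-β + ε) ∂μ ≤
          C' * δ ^ α * |Real.log δ| ^ β₀ * Real.exp (-ε * θ * |Real.log δ| ^ τ)) := by
  have hq : 0 < σ - p + 1 := by linarith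
  have hβ0 : 0 < β := by rw [hβ]; exact div_pos (by linarith) hq
  have hα1 : 1 ≤ α := by
    rw [hα, le_div_iff₀ hq]
    nlinarith
  have hτ0 : 0 ≤ τ := by linarith [(le_max_right _ _).trans_lt hτ]
  have hβ₀0 : 0 ≤ β₀ := by linarith
  have hc : 0 < volume.real (ball (0 : EuclideanSpace ℝ (Fin m)) 1) :=
    ENNReal.toReal_pos (measure_ball_pos _ _ one_pos).ne' measure_ball_lt_top.ne
  have hm0 : (0 : ℝ) < m := by exact_mod_cast (by omega : 0 < m)
  set κ := volume.real (ball (0 : EuclideanSpace ℝ (Fin m)) 1)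
  have key : ∀ δ : ℝ, 0 < δ → δ < δstar → ∀ ε : ℝ, 0 < ε →
      ∫ x in ballStrip m δ \ ballStrip m (δ / 2), V x ^ (-β + ε) ∂μ ≤
        2 ^ β₀ * (κ * m) * Real.exp (-ε * θ * |Real.log δ| ^ τ) * δ ^ α *
          |Real.log δ| ^ β₀ := by
    intro δ hδ hδ' ε hε
    have hsub : ballStrip m δ \ ballStrip m (δ / 2) ⊆ ballStrip m δ := sdiff_subset
    have hfin : volume (ballStrip m δ) < ∞ :=
      (measure_mono fun x hx => mem_ball_zero_iff.2 hx.1).trans_lt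
        (measure_ball_lt_top (x := (0 : EuclideanSpace ℝ (Fin m))) (r := 1))
    have hvol : volume.real (ballStrip m δ \ ballStrip m (δ / 2)) ≤ κ * m * δ :=
      (measureReal_mono hsub hfin.ne).trans (volume_real_ballStrip_le m hδ (by linarith))
    have hstrip := hsub.trans (ballStrip_mono m hδ'.le)
    rw [hμ]
    refine (setIntegral_withDensity_ofReal_le
      (M := δ ^ (α - 1) * (2 ^ β₀ * |Real.log δ| ^ β₀) *
        Real.exp (-(ε * θ) * |Real.log δ| ^ τ))
      (measurableSet_ballStrip m δstar)
      ((measurableSet_ballStrip m δ).diff (measurableSet_ballStrip m (δ / 2)))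
      hstrip ((measure_mono hsub).trans_lt hfin) (by fun_prop) ha ?_ ?_).trans ?_
    · intro x hx
      have : 0 ≤ 1 - ‖x‖ := by linarith [hx.1.1]
      positivity
    · intro x hx
      have hx2 : δ / 2 ≤ 1 - ‖x‖ := not_lt.1 fun h => hx.2 ⟨hx.1.1, h⟩
      refine le_of_eq_of_le ?_ (rpow_mul_abs_log_rpow_mul_exp_le hα1 hβ₀0
        (mul_pos hε hθ).le hτ0 hδ (by linarith) hx2 hx.1.2.le)
      rw [hV x (hstrip hx), ← Real.exp_mul, Real.abs_exp, mul_assoc, ← Real.exp_add]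
      ring_nf
    · calc _ ≤ δ ^ (α - 1) * (2 ^ β₀ * |Real.log δ| ^ β₀) *
            Real.exp (-(ε * θ) * |Real.log δ| ^ τ) * (κ * m * δ) := by gcongr
        _ = _ := by
          rw [Real.rpow_sub_one hδ.ne']
          field_simp
  refine ⟨⟨2 ^ β₀ * (κ * m), by positivity, δstar / 2, by linarith, by linarith,
      fun δ h0 h1 ε hε _ => key δ h0 (by linarith) ε hε⟩,
    ⟨2 ^ β₀ * (κ * m), by positivity, δstar, hδs, by linarith, β / 2, by linarith,
      by linarith, fun δ h0 h1 ε hε _ => (key δ h0 h1 ε hε).trans_eq (by ring)⟩⟩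
end
end

section
/- There exist a constant C > 0 and δ₁ ∈ (0, δ*) such that ∫_{S^δ ∖ S^{δ/2}} V^{−β} dμ ≥ C δ^α |log δ|^{β₀} for every δ ∈ (0, δ₁). Consequently, since β₀ > β, condition (HP1) fails for this choice of a and V: there are no constants C' > 0, C₀ > 0, k ∈ [0, β), δ₀ ∈ (0, 1), ε₀ ∈ (0, min{(α−1)/C₀, β}) such that ∫_{S^δ ∖ S^{δ/2}} V^{−β+ε} dμ ≤ C' δ^{α−C₀ε} |log δ|^k for every δ ∈ (0, δ₀) and ε ∈ (0, ε₀). -/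
open MeasureTheory Metric Set
open scoped ENNReal

noncomputable section

open Filter Topology

theorem ballStrip_diff_eq (m : ℕ) (δ : ℝ) :
    ballStrip m δ \ ballStrip m (δ / 2) = closedBall 0 (1 - δ / 2) \ closedBall 0 (1 - δ) := by
  ext x
  simp only [ballStrip, Set.mem_sdiff, mem_ofPred_eq, mem_closedBall, dist_zero_right, not_and,
    not_lt, not_le]
  constructor
  · rintro ⟨⟨h1, h2⟩, h3⟩
    have := h3 h1
    constructor <;> linarith
  · rintro ⟨h1, h2⟩
    exact ⟨⟨by linarith, by linarith⟩, fun _ => by linarith⟩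

theorem volume_real_ballStrip_diff_ge {m : ℕ} (hm : m ≠ 0) {δ : ℝ} (hδ : 0 < δ) (hδ1 : δ < 1) :
    (1 / 2) ^ m * volume.real (ball (0 : EuclideanSpace ℝ (Fin m)) 1) * (δ / 2) ≤
      volume.real (ballStrip m δ \ ballStrip m (δ / 2)) := by
  obtain ⟨n, rfl⟩ := Nat.exists_eq_succ_of_ne_zero hm
  rw [ballStrip_diff_eq, measureReal_sdiff (closedBall_subset_closedBall (by linarith))
    measurableSet_closedBall measure_closedBall_lt_top.ne,
    Measure.addHaar_real_closedBall _ _ (by linarith),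
    Measure.addHaar_real_closedBall _ _ (by linarith), finrank_euclideanSpace_fin, ← sub_mul]
  have hω : 0 ≤ volume.real (ball (0 : EuclideanSpace ℝ (Fin (n + 1))) 1) := measureReal_nonneg
  have h1 : (1 - δ) ^ n ≤ (1 - δ / 2) ^ n := pow_le_pow_left₀ (by linarith) (by linarith) n
  have h2 : (1 / 2 : ℝ) ^ n ≤ (1 - δ / 2) ^ n := pow_le_pow_left₀ (by norm_num) (by linarith) n
  have h3 : (0 : ℝ) < (1 / 2) ^ n := by positivity
  have h4 : (1 / 2 : ℝ) ^ (n + 1) * (δ / 2) ≤ (1 - δ / 2) ^ (n + 1) - (1 - δ) ^ (n + 1) := by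
    simp only [pow_succ]
    have h5 := mul_le_mul_of_nonneg_right h1 (by linarith : 0 ≤ 1 - δ)
    have h6 := mul_le_mul_of_nonneg_right h2 hδ.le
    have h7 := mul_pos h3 hδ
    linarith
  calc _ = (1 / 2 : ℝ) ^ (n + 1) * (δ / 2) * volume.real (ball 0 1) := mul_right_comm ..
    _ ≤ _ := mul_le_mul_of_nonneg_right h4 hω

/-- Integrals against a density on a strip reduce to Lebesgue integrals of a function that agrees
with the product of density and integrand there. -/
theorem setIntegral_withDensity_ofReal_restrict {X : Type*} [MeasurableSpace X] {ν : Measure X}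
    {S A : Set X} (hA : MeasurableSet A) (hAS : A ⊆ S) {a g f h : X → ℝ} (hg : Measurable g)
    (hg0 : ∀ x ∈ A, 0 ≤ g x) (hag : ∀ x ∈ A, a x = g x) (hh : ∀ x ∈ A, g x * f x = h x) :
    ∫ x in A, f x ∂((ν.restrict S).withDensity fun x => ENNReal.ofReal (a x)) =
      ∫ x in A, h x ∂ν := by
  rw [restrict_withDensity hA, Measure.restrict_restrict_of_subset hAS,
    withDensity_congr_ae (g := fun x => ENNReal.ofReal (g x)),
    integral_withDensity_eq_integral_toReal_smul hg.ennreal_ofReal (by simp)]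
  · refine setIntegral_congr_fun hA fun x hx => ?_
    simp only [ENNReal.toReal_ofReal (hg0 x hx), smul_eq_mul, hh x hx]
  · filter_upwards [ae_restrict_mem hA] with x hx
    rw [hag x hx]

theorem setIntegral_ballStrip_diff_ge {m : ℕ} (hm : m ≠ 0) {α β₀ κ τ δ : ℝ} (hα : 1 ≤ α)
    (hβ₀ : 0 ≤ β₀) (hκ : 0 ≤ κ) (hτ : 0 ≤ τ) (hδ : 0 < δ) (hδ1 : δ < 1) :
    Real.exp (-κ * |Real.log (δ / 2)| ^ τ) *
        ((1 / 2) ^ m * volume.real (ball (0 : EuclideanSpace ℝ (Fin m)) 1) * (1 / 2) ^ α *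
          δ ^ α * |Real.log δ| ^ β₀) ≤
      ∫ x : EuclideanSpace ℝ (Fin m) in ballStrip m δ \ ballStrip m (δ / 2),
        (1 - ‖x‖) ^ (α - 1) * |Real.log (1 - ‖x‖)| ^ β₀ *
          Real.exp (-κ * |Real.log (1 - ‖x‖)| ^ τ) := by
  set A := ballStrip m δ \ ballStrip m (δ / 2) with hAdef
  have hA : A = closedBall 0 (1 - δ / 2) \ closedBall 0 (1 - δ) := ballStrip_diff_eq m δ
  have hAm : MeasurableSet A := hA ▸ measurableSet_closedBall.diff measurableSet_closedBall
  have hAfin : volume A ≠ ∞ :=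
    ((measure_mono (hA ▸ sdiff_subset)).trans_lt measure_closedBall_lt_top).ne
  have hd : ∀ x ∈ A, δ / 2 ≤ 1 - ‖x‖ ∧ 1 - ‖x‖ < δ := by
    intro x hx
    rw [hA] at hx
    simp only [Set.mem_sdiff, mem_closedBall, dist_zero_right, not_le] at hx
    exact ⟨by linarith [hx.1], by linarith [hx.2]⟩
  have hlog : ∀ x ∈ A, |Real.log δ| ≤ |Real.log (1 - ‖x‖)| ∧
      |Real.log (1 - ‖x‖)| ≤ |Real.log (δ / 2)| := by
    intro x hx
    obtain ⟨h1, h2⟩ := hd x hx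
    have hpos : 0 < 1 - ‖x‖ := by linarith
    rw [abs_of_nonpos (Real.log_nonpos hδ.le hδ1.le),
      abs_of_nonpos (Real.log_nonpos hpos.le (by linarith)),
      abs_of_nonpos (Real.log_nonpos (by linarith) (by linarith))]
    exact ⟨neg_le_neg (Real.log_le_log hpos h2.le),
      neg_le_neg (Real.log_le_log (by linarith) h1)⟩
  have hint : IntegrableOn (fun x : EuclideanSpace ℝ (Fin m) =>
      (1 - ‖x‖) ^ (α - 1) * |Real.log (1 - ‖x‖)| ^ β₀ *
        Real.exp (-κ * |Real.log (1 - ‖x‖)| ^ τ)) A := by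
    refine Measure.integrableOn_of_bounded (M := 1 * |Real.log (δ / 2)| ^ β₀ * 1) hAfin
      (Measurable.aestronglyMeasurable (by fun_prop)) ?_
    filter_upwards [ae_restrict_mem hAm] with x hx
    obtain ⟨h1, h2⟩ := hd x hx
    have hpos : 0 < 1 - ‖x‖ := by linarith
    rw [Real.norm_of_nonneg (by positivity)]
    have h3 : (1 - ‖x‖) ^ (α - 1) ≤ 1 :=
      Real.rpow_le_one hpos.le (by linarith) (by linarith)
    have h4 : |Real.log (1 - ‖x‖)| ^ β₀ ≤ |Real.log (δ / 2)| ^ β₀ :=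
      Real.rpow_le_rpow (abs_nonneg _) (hlog x hx).2 hβ₀
    have h5 : Real.exp (-κ * |Real.log (1 - ‖x‖)| ^ τ) ≤ 1 := by
      rw [Real.exp_le_one_iff, neg_mul, neg_nonpos]
      positivity
    gcongr
  have hmain := setIntegral_ge_of_const_le_real
    (c := (δ / 2) ^ (α - 1) * |Real.log δ| ^ β₀ * Real.exp (-κ * |Real.log (δ / 2)| ^ τ))
    hAm hAfin (fun x hx => ?_) hint
  · refine le_trans ?_ hmain
    have hvol := volume_real_ballStrip_diff_ge hm hδ hδ1
    have hpow : (1 / 2 : ℝ) ^ α * δ ^ α = (δ / 2) ^ (α - 1) * (δ / 2) := by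
      rw [← Real.mul_rpow (by norm_num) hδ.le, Real.rpow_sub_one (by positivity)]
      field_simp
    calc _ = (δ / 2) ^ (α - 1) * |Real.log δ| ^ β₀ * Real.exp (-κ * |Real.log (δ / 2)| ^ τ) *
          ((1 / 2) ^ m * volume.real (ball (0 : EuclideanSpace ℝ (Fin m)) 1) * (δ / 2)) := by
          linear_combination Real.exp (-κ * |Real.log (δ / 2)| ^ τ) * (1 / 2) ^ m *
            volume.real (ball (0 : EuclideanSpace ℝ (Fin m)) 1) * |Real.log δ| ^ β₀ * hpow
      _ ≤ _ := by gcongr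
  · obtain ⟨h1, h2⟩ := hd x hx
    have hpos : 0 < 1 - ‖x‖ := by linarith
    obtain ⟨h3, h4⟩ := hlog x hx
    have h5 : |Real.log (1 - ‖x‖)| ^ τ ≤ |Real.log (δ / 2)| ^ τ :=
      Real.rpow_le_rpow (abs_nonneg _) h4 hτ
    have h6 : -κ * |Real.log (δ / 2)| ^ τ ≤ -κ * |Real.log (1 - ‖x‖)| ^ τ := by
      nlinarith
    have h7 : 0 ≤ α - 1 := by linarith
    gcongr

/-- A higher power of `|log δ|` is not bounded by a lower one as `δ → 0⁺`. -/
theorem exists_lt_mul_abs_log_rpow {b k C C' η : ℝ} (hkb : k < b) (hC : 0 < C) (hη : 0 < η) :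
    ∃ δ, 0 < δ ∧ δ < η ∧ C' * |Real.log δ| ^ k < C * |Real.log δ| ^ b := by
  have h1 : Tendsto (fun L : ℝ => C * L ^ (b - k)) atTop atTop :=
    (tendsto_rpow_atTop (sub_pos.2 hkb)).const_mul_atTop hC
  obtain ⟨L, hL, hL0, hLη⟩ := ((h1.eventually_gt_atTop C').and
    ((eventually_gt_atTop 0).and (eventually_gt_atTop (-Real.log η)))).exists
  refine ⟨Real.exp (-L), Real.exp_pos _, ?_, ?_⟩
  · rw [← Real.lt_log_iff_exp_lt hη]
    linarith
  · rw [Real.log_exp, abs_neg, abs_of_pos hL0]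
    have := mul_lt_mul_of_pos_right hL (Real.rpow_pos_of_pos hL0 k)
    rwa [mul_assoc, ← Real.rpow_add hL0, sub_add_cancel] at this

/-- **Example: (HP1) fails.**  For `a(x) = d(x)^{α-1} |log d(x)|^{β₀} e^{-βθ|log d(x)|^τ}`
and `V(x) = e^{-θ|log d(x)|^τ}` on `S^{δ*}` (where `d(x) = 1 - |x|`), one has
`∫_{S^δ ∖ S^{δ/2}} V^{-β} dμ ≥ C δ^α |log δ|^{β₀}` for all small `δ`; consequently, since
`β₀ > β`, condition (HP1) cannot hold for this choice of `a` and `V`. -/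
theorem example_HP1_fails {m : ℕ} (hm : 2 ≤ m)
    (p σ α β δstar β₀ θ τ : ℝ)
    (hp : 1 < p) (hσ : p - 1 < σ)
    (hα : α = p * σ / (σ - p + 1)) (hβ : β = (p - 1) / (σ - p + 1))
    (hδs : 0 < δstar) (hδs2 : δstar < 1 / 2)
    (hβ₀ : β < β₀) (hθ : 0 < θ) (hτ : max ((σ - p + 1) * (β₀ + 1) / σ) 1 < τ)
    (a V : EuclideanSpace ℝ (Fin m) → ℝ)
    (ha : ∀ x ∈ ballStrip m δstar,
      a x = (1 - ‖x‖) ^ (α - 1) * |Real.log (1 - ‖x‖)| ^ β₀ *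
        Real.exp (-β * θ * |Real.log (1 - ‖x‖)| ^ τ))
    (hV : ∀ x ∈ ballStrip m δstar,
      V x = Real.exp (-θ * |Real.log (1 - ‖x‖)| ^ τ))
    (μ : Measure (EuclideanSpace ℝ (Fin m)))
    (hμ : μ = (volume.restrict (ballStrip m δstar)).withDensity
      fun x => ENNReal.ofReal (a x)) :
    (∃ C > (0:ℝ), ∃ δ₁ : ℝ, 0 < δ₁ ∧ δ₁ < δstar ∧
      ∀ δ : ℝ, 0 < δ → δ < δ₁ →
        C * δ ^ α * |Real.log δ| ^ β₀ ≤
          ∫ x in ballStrip m δ \ ballStrip m (δ / 2), V x ^ (-β) ∂μ) ∧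
    -- consequently, condition (HP1) fails
    ¬ (∃ C' > (0:ℝ), ∃ C₀ > (0:ℝ), ∃ k : ℝ, 0 ≤ k ∧ k < β ∧
      ∃ δ₀ : ℝ, 0 < δ₀ ∧ δ₀ < 1 ∧
      ∃ ε₀ : ℝ, 0 < ε₀ ∧ ε₀ < min ((α - 1) / C₀) β ∧
      ∀ δ : ℝ, 0 < δ → δ < δ₀ → ∀ ε : ℝ, 0 < ε → ε < ε₀ →
        ∫ x in ballStrip m δ \ ballStrip m (δ / 2), V x ^ (-β + ε) ∂μ ≤
          C' * δ ^ (α - C₀ * ε) * |Real.log δ| ^ k) := by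
  have hD : 0 < σ - p + 1 := by linarith
  have hα1 : 1 < α := by
    rw [hα, one_lt_div hD]
    nlinarith
  have hβpos : 0 < β := hβ ▸ div_pos (by linarith) hD
  have hτ1 : 1 < τ := (le_max_right _ _).trans_lt hτ
  have hm0 : m ≠ 0 := by omega
  set C : ℝ := (1 / 2) ^ m * volume.real (ball (0 : EuclideanSpace ℝ (Fin m)) 1) * (1 / 2) ^ α
    with hCdef
  have hC : 0 < C := by
    have : 0 < volume.real (ball (0 : EuclideanSpace ℝ (Fin m)) 1) :=
      ENNReal.toReal_pos (measure_ball_pos _ _ one_pos).ne' measure_ball_lt_top.ne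
    positivity
  have hlower : ∀ δ : ℝ, 0 < δ → δ < δstar → ∀ ε : ℝ, 0 ≤ ε →
      Real.exp (-(ε * θ) * |Real.log (δ / 2)| ^ τ) * (C * δ ^ α * |Real.log δ| ^ β₀) ≤
        ∫ x in ballStrip m δ \ ballStrip m (δ / 2), V x ^ (-β + ε) ∂μ := by
    intro δ hδ hδs' ε hε
    have hsub : ballStrip m δ \ ballStrip m (δ / 2) ⊆ ballStrip m δstar :=
      fun x hx => ⟨hx.1.1, hx.1.2.trans hδs'⟩
    have hmeas : MeasurableSet (ballStrip m δ \ ballStrip m (δ / 2)) :=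
      ballStrip_diff_eq m δ ▸ measurableSet_closedBall.diff measurableSet_closedBall
    refine (setIntegral_ballStrip_diff_ge hm0 hα1.le (hβpos.trans hβ₀).le (by positivity)
      (by linarith) hδ (by linarith)).trans_eq ?_
    rw [hμ]
    refine (setIntegral_withDensity_ofReal_restrict hmeas hsub (by fun_prop) (fun x hx => ?_)
      (fun x hx => ha x (hsub hx)) (fun x hx => ?_)).symm
    · have : 0 < 1 - ‖x‖ := sub_pos.2 hx.1.1
      positivity
    · rw [hV x (hsub hx), ← Real.exp_mul, mul_assoc, ← Real.exp_add]
      congr 2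
      ring
  refine ⟨⟨C, hC, δstar / 2, by linarith, by linarith, fun δ hδ hδ1 => ?_⟩, ?_⟩
  · simpa using hlower δ hδ (by linarith) 0 le_rfl
  · rintro ⟨C', -, C₀, -, k, -, hkβ, δ₀, hδ₀, -, ε₀, hε₀, -, hHP⟩
    obtain ⟨δ, hδ, hδη, hlt⟩ := exists_lt_mul_abs_log_rpow (C' := C') (hkβ.trans hβ₀) hC
      (lt_min hδs hδ₀)
    have hle : Real.exp (-(0 * θ) * |Real.log (δ / 2)| ^ τ) * (C * δ ^ α * |Real.log δ| ^ β₀) ≤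
        C' * δ ^ (α - C₀ * 0) * |Real.log δ| ^ k := by
      refine le_of_tendsto_of_tendsto (b := 𝓝[>] (0 : ℝ))
        (f := fun ε => Real.exp (-(ε * θ) * |Real.log (δ / 2)| ^ τ) *
          (C * δ ^ α * |Real.log δ| ^ β₀))
        (g := fun ε => C' * δ ^ (α - C₀ * ε) * |Real.log δ| ^ k) ?_ ?_ ?_
      · exact (Continuous.tendsto (by fun_prop) 0).mono_left nhdsWithin_le_nhds
      · have : Continuous fun ε : ℝ => C' * δ ^ (α - C₀ * ε) * |Real.log δ| ^ k :=
          (continuous_const.mul (continuous_const.rpow (by fun_prop)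
            fun _ => Or.inl hδ.ne')).mul continuous_const
        exact (this.tendsto 0).mono_left nhdsWithin_le_nhds
      · filter_upwards [Ioo_mem_nhdsGT hε₀] with ε hε
        exact (hlower δ hδ (hδη.trans_le (min_le_left _ _)) ε hε.1.le).trans
          (hHP δ hδ (hδη.trans_le (min_le_right _ _)) ε hε.1 hε.2)
    simp only [zero_mul, neg_zero, Real.exp_zero, one_mul, mul_zero, sub_zero] at hle
    have := mul_lt_mul_of_pos_right hlt (Real.rpow_pos_of_pos hδ α)
    linarith
end
end

section
/- For every λ ∈ (0, ε) there exists δ ∈ (0, 1/2) such that the function ζ(r) := (1 − r) |log(1 − r)|^λ satisfies, for every r ∈ (1 − δ, 1): ζ''(r) + ((m−1)/r) ζ'(r) + v(r) ζ(r)^σ ≤ 0 and ζ'(r) < 0, where v(r) := c (1 − r)^{−(σ+1)} |log(1 − r)|^{−1−ε(σ−1)}. -/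
open Set

noncomputable section

/-- The derivative of `s ↦ -log (1 - s)`. -/
lemma hasDerivAt_neg_log_one_sub {s : ℝ} (hs : s < 1) :
    HasDerivAt (fun s : ℝ => -Real.log (1 - s)) (1 - s)⁻¹ s := by
  have h := (((hasDerivAt_id s).const_sub 1).log (sub_pos.2 hs).ne').neg
  exact h.congr_deriv (by simp [neg_div])

/-- Where `0 < s < 1`, the derivative of a real power of `s ↦ -log (1 - s)`. -/
lemma hasDerivAt_neg_log_one_sub_rpow {s : ℝ} (hs₀ : 0 < s) (hs : s < 1) (p : ℝ) :
    HasDerivAt (fun s : ℝ => (-Real.log (1 - s)) ^ p)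
      ((1 - s)⁻¹ * p * (-Real.log (1 - s)) ^ (p - 1)) s :=
  (hasDerivAt_neg_log_one_sub hs).rpow_const
    (Or.inl (neg_pos.2 (Real.log_neg (by linarith) (by linarith))).ne')

lemma abs_log_one_sub {s : ℝ} (hs₀ : 0 < s) (hs : s < 1) :
    |Real.log (1 - s)| = -Real.log (1 - s) :=
  abs_of_neg (Real.log_neg (by linarith) (by linarith))

lemma hasDerivAt_one_sub_mul_abs_log_rpow {s : ℝ} (hs₀ : 0 < s) (hs : s < 1) (p : ℝ) :
    HasDerivAt (fun s : ℝ => (1 - s) * |Real.log (1 - s)| ^ p)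
      (-(-Real.log (1 - s)) ^ p + p * (-Real.log (1 - s)) ^ (p - 1)) s := by
  have h := ((hasDerivAt_id s).const_sub 1).mul (hasDerivAt_neg_log_one_sub_rpow hs₀ hs p)
  refine (h.congr_deriv ?_).congr_of_eventuallyEq ?_
  · have : 1 - s ≠ 0 := (sub_pos.2 hs).ne'
    simp only [id]
    field_simp
  · filter_upwards [Ioo_mem_nhds hs₀ hs] with x hx
    simp [abs_log_one_sub hx.1 hx.2]

lemma deriv_deriv_one_sub_mul_abs_log_rpow {s : ℝ} (hs₀ : 0 < s) (hs : s < 1) (p : ℝ) :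
    deriv (deriv fun s : ℝ => (1 - s) * |Real.log (1 - s)| ^ p) s =
      (1 - s)⁻¹ * (-p * (-Real.log (1 - s)) ^ (p - 1) +
        p * (p - 1) * (-Real.log (1 - s)) ^ (p - 1 - 1)) := by
  have h := (hasDerivAt_neg_log_one_sub_rpow hs₀ hs p).neg.add
    ((hasDerivAt_neg_log_one_sub_rpow hs₀ hs (p - 1)).const_mul p)
  refine ((h.congr_of_eventuallyEq ?_).deriv).trans (by ring)
  filter_upwards [Ioo_mem_nhds hs₀ hs] with x hx
  exact (hasDerivAt_one_sub_mul_abs_log_rpow hx.1 hx.2 p).deriv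

/-- The lower order terms are eventually dominated by the constant `p > 0`. -/
lemma exists_forall_ge_lower_order_neg {p a : ℝ} (c : ℝ) (hp : 0 < p) (ha : 0 < a) :
    ∃ M : ℝ, p < M ∧ ∀ L : ℝ, M ≤ L → -p + p * (p - 1) * L⁻¹ + c * L ^ (-a) < 0 := by
  have h : Filter.Tendsto (fun L : ℝ => -p + p * (p - 1) * L⁻¹ + c * L ^ (-a))
      Filter.atTop (nhds (-p + p * (p - 1) * 0 + c * 0)) :=
    (tendsto_const_nhds.add (tendsto_inv_atTop_zero.const_mul _)).add
      ((tendsto_rpow_neg_atTop ha).const_mul _)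
  obtain ⟨M, hM⟩ := Filter.eventually_atTop.1 (h.eventually_lt_const (u := 0) (by simpa using hp))
  exact ⟨max M (p + 1), lt_max_of_lt_right (by linarith),
    fun L hL => hM L ((le_max_left _ _).trans hL)⟩

/-- The power nonlinearity evaluated on `t L ^ p`, in factored form. -/
lemma potential_mul_rpow_eq {t L : ℝ} (ht : 0 < t) (hL : 0 < L) (c σ ε p : ℝ) :
    c * t ^ (-(σ + 1)) * L ^ (-1 - ε * (σ - 1)) * (t * L ^ p) ^ σ =
      t⁻¹ * L ^ (p - 1) * (c * L ^ (-((ε - p) * (σ - 1)))) := by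
  have h₁ : t ^ (-(σ + 1)) * t ^ σ = t⁻¹ := by
    rw [← Real.rpow_add ht, ← Real.rpow_neg_one]
    congr 1
    ring
  have h₂ : L ^ (-1 - ε * (σ - 1)) * L ^ (p * σ) =
      L ^ (p - 1) * L ^ (-((ε - p) * (σ - 1))) := by
    rw [← Real.rpow_add hL, ← Real.rpow_add hL]
    congr 1
    ring
  rw [Real.mul_rpow ht.le (Real.rpow_nonneg hL.le _), ← Real.rpow_mul hL.le]
  linear_combination (c * L ^ (-1 - ε * (σ - 1)) * L ^ (p * σ)) * h₁ + (c * t⁻¹) * h₂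

/-- **Step 1 of the counterexample construction.**  For every `λ ∈ (0, ε)` the function
`ζ(r) = (1-r)|log(1-r)|^λ` satisfies, for `r` close enough to `1`,
`ζ'' + ((m-1)/r) ζ' + v ζ^σ ≤ 0` and `ζ' < 0`, where
`v(r) = c (1-r)^{-(σ+1)} |log(1-r)|^{-1-ε(σ-1)}`. -/
theorem zeta_radial_supersolution {m : ℕ} (hm : 2 ≤ m)
    (σ ε c : ℝ) (hσ : 1 < σ) (hε : 0 < ε) (hε2 : ε < 1 / (σ - 1)) (hc : 0 < c)
    (v : ℝ → ℝ)
    (hv : ∀ r : ℝ, 0 < r → r < 1 →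
      v r = c * (1 - r) ^ (-(σ + 1)) * |Real.log (1 - r)| ^ (-1 - ε * (σ - 1))) :
    ∀ lam : ℝ, 0 < lam → lam < ε →
      ∃ δ : ℝ, 0 < δ ∧ δ < 1 / 2 ∧
        ∀ r : ℝ, 1 - δ < r → r < 1 →
          (deriv (deriv fun s : ℝ => (1 - s) * |Real.log (1 - s)| ^ lam) r +
              ((m - 1 : ℝ) / r) * deriv (fun s : ℝ => (1 - s) * |Real.log (1 - s)| ^ lam) r +
              v r * ((1 - r) * |Real.log (1 - r)| ^ lam) ^ σ ≤ 0) ∧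
          deriv (fun s : ℝ => (1 - s) * |Real.log (1 - s)| ^ lam) r < 0 := by
  intro lam hlam hlamε
  obtain ⟨M, hpM, hM⟩ := exists_forall_ge_lower_order_neg c hlam
    (mul_pos (sub_pos.2 hlamε) (sub_pos.2 hσ))
  refine ⟨min (1 / 4) (Real.exp (-M)), lt_min (by norm_num) (Real.exp_pos _),
    (min_le_left _ _).trans_lt (by norm_num), fun r hr hr₁ => ?_⟩
  have hr₀ : 0 < r := by linarith [min_le_left (1 / 4) (Real.exp (-M))]
  have ht : 0 < 1 - r := sub_pos.2 hr₁
  have hML : M ≤ -Real.log (1 - r) := by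
    have := (Real.log_le_iff_le_exp ht).2
      (show 1 - r ≤ Real.exp (-M) by linarith [min_le_right (1 / 4) (Real.exp (-M))])
    linarith
  rw [(hasDerivAt_one_sub_mul_abs_log_rpow hr₀ hr₁ lam).deriv,
    deriv_deriv_one_sub_mul_abs_log_rpow hr₀ hr₁, hv r hr₀ hr₁, abs_log_one_sub hr₀ hr₁]
  set L := -Real.log (1 - r)
  have hL : 0 < L := by linarith
  have hLp : 0 < L ^ (lam - 1) := Real.rpow_pos_of_pos hL _
  have hderiv : -L ^ lam + lam * L ^ (lam - 1) < 0 := by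
    have : L ^ lam = L * L ^ (lam - 1) := by
      rw [Real.rpow_sub_one hL.ne', mul_div_cancel₀ _ hL.ne']
    rw [this]
    nlinarith
  refine ⟨?_, hderiv⟩
  rw [potential_mul_rpow_eq ht hL, Real.rpow_sub_one hL.ne' (lam - 1), div_eq_mul_inv]
  have hm₁ : (0 : ℝ) ≤ (m - 1) / r :=
    div_nonneg (sub_nonneg.2 (by exact_mod_cast (by omega : 1 ≤ m))) hr₀.le
  have hfirst := mul_nonpos_of_nonneg_of_nonpos hm₁ hderiv.le
  have hmain := mul_nonpos_of_nonneg_of_nonpos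
    (mul_pos (inv_pos.2 ht) hLp).le (hM L hML).le
  linarith
end
end
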